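/- arXiv:1207.0953 — 12 statements merged into one kernel-verified Lean document; each statement's English description precedes it below -/
import Mathlib

section
/- Let G = (V,E) be a finite simple graph and let ω(v) = |N[v]|, ω(D) = Σ_{d∈D} ω(d). If D ⊆ V is an efficient dominating set of G, then D is a minimum-weight dominating set and a maximum-weight independent set of G²; that is, ω(D) ≤ ω(D') for every dominating set D' of G, and ω(D'') ≤ ω(D) for every set D'' ⊆ V that is independent in the square G². -/
/-- In a finite simple graph `G`, with weight `ω(v) = |N[v]|` and
`ω(D) = Σ_{d ∈ D} ω(d)`, every efficient dominating set `D` is a minimum-weight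
dominating set of `G` and a maximum-weight independent set of the square `G²`. -/
theorem efficientDominating_minimum_maximum {V : Type*} [Fintype V] [DecidableEq V]
    (G : SimpleGraph V) [DecidableRel G.Adj] (D : Finset V)
    (hed : ∀ v : V, ∃! d, d ∈ D ∧ (v = d ∨ G.Adj d v)) :
    (∀ D' : Finset V, (∀ v : V, ∃ d ∈ D', v = d ∨ G.Adj d v) →
       ∑ d ∈ D, ((G.neighborFinset d).card + 1) ≤ ∑ d ∈ D', ((G.neighborFinset d).card + 1)) ∧
    (∀ D'' : Finset V,
       (∀ x ∈ D'', ∀ y ∈ D'', x ≠ y → ¬ (G.Adj x y ∨ ∃ u, G.Adj x u ∧ G.Adj u y)) →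
       ∑ d ∈ D'', ((G.neighborFinset d).card + 1) ≤ ∑ d ∈ D, ((G.neighborFinset d).card + 1)) := by
  have hw : ∀ d, (G.neighborFinset d).card + 1 = (insert d (G.neighborFinset d)).card := by
    intro d
    rw [Finset.card_insert_of_notMem]
    simp
  simp only [hw]
  have hdom : ∀ S : Finset V, (∀ v : V, ∃ d ∈ S, v = d ∨ G.Adj d v) →
      Fintype.card V ≤ ∑ d ∈ S, (insert d (G.neighborFinset d)).card := by
    intro S hS
    have h : S.biUnion (fun d => insert d (G.neighborFinset d)) = Finset.univ := by
      ext v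
      simpa using hS v
    rw [← Finset.card_univ, ← h]
    exact Finset.card_biUnion_le
  have hpack : ∀ S : Finset V, (∀ x ∈ S, ∀ y ∈ S, x ≠ y →
      Disjoint (insert x (G.neighborFinset x)) (insert y (G.neighborFinset y))) →
      ∑ d ∈ S, (insert d (G.neighborFinset d)).card ≤ Fintype.card V := by
    intro S hS
    rw [← Finset.card_biUnion hS]
    exact Finset.card_le_univ _
  constructor
  · intro D' hD'
    refine (hpack D ?_).trans (hdom D' hD')
    intro x hx y hy hxy
    rw [Finset.disjoint_left]
    intro v hvx hvy
    simp only [Finset.mem_insert, SimpleGraph.mem_neighborFinset] at hvx hvy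
    exact hxy ((hed v).unique ⟨hx, hvx⟩ ⟨hy, hvy⟩)
  · intro D'' hD''
    refine (hpack D'' ?_).trans (hdom D fun v => ?_)
    · intro x hx y hy hxy
      rw [Finset.disjoint_left]
      intro v hvx hvy
      simp only [Finset.mem_insert, SimpleGraph.mem_neighborFinset] at hvx hvy
      apply hD'' x hx y hy hxy
      rcases hvx with rfl | hvx
      · rcases hvy with rfl | hvy
        · exact absurd rfl hxy
        · exact Or.inl hvy.symm
      · rcases hvy with rfl | hvy
        · exact Or.inl hvx
        · exact Or.inr ⟨v, hvx, hvy.symm⟩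
    · obtain ⟨d, ⟨h1, h2⟩, -⟩ := hed v
      exact ⟨d, h1, h2⟩
end

section
/- Let G = (V,E) be a finite simple graph with an efficient edge dominating set M. If x, y, z are three pairwise adjacent vertices of G (a triangle), then exactly one of the three edges xy, yz, xz belongs to M. -/
/-- If `M` is an efficient edge dominating set of a finite simple graph `G`
(every edge shares an endpoint with exactly one edge of `M`), then every triangle of `G`
contains exactly one edge of `M`. -/
theorem eed_triangle_exactly_one_edge {V : Type*} [Fintype V] (G : SimpleGraph V)
    (M : Set (Sym2 V)) (hM : M ⊆ G.edgeSet)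
    (heed : ∀ e ∈ G.edgeSet, ∃! f, f ∈ M ∧ ∃ x, x ∈ e ∧ x ∈ f)
    (x y z : V) (hxy : G.Adj x y) (hyz : G.Adj y z) (hxz : G.Adj x z) :
    (s(x, y) ∈ M ∧ s(y, z) ∉ M ∧ s(x, z) ∉ M) ∨
    (s(y, z) ∈ M ∧ s(x, y) ∉ M ∧ s(x, z) ∉ M) ∨
    (s(x, z) ∈ M ∧ s(x, y) ∉ M ∧ s(y, z) ∉ M) := by
  have U : ∀ u v, G.Adj u v → ∀ a ∈ M, ∀ b ∈ M, (u ∈ a ∨ v ∈ a) → (u ∈ b ∨ v ∈ b) → a = b := by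
    intro u v huv a ha b hb h1 h2
    refine (heed s(u, v) huv).unique ⟨ha, ?_⟩ ⟨hb, ?_⟩
    · rcases h1 with h | h
      · exact ⟨u, by simp, h⟩
      · exact ⟨v, by simp, h⟩
    · rcases h2 with h | h
      · exact ⟨u, by simp, h⟩
      · exact ⟨v, by simp, h⟩
  have D : ∀ u v, G.Adj u v → ∃ a ∈ M, u ∈ a ∨ v ∈ a := by
    intro u v huv
    obtain ⟨f, ⟨hf, w, hw, hwf⟩, -⟩ := heed s(u, v) huv
    rcases Sym2.mem_iff.1 hw with rfl | rfl
    · exact ⟨f, hf, Or.inl hwf⟩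
    · exact ⟨f, hf, Or.inr hwf⟩
  have E : ∀ u v, G.Adj u v → ∀ a ∈ M, ∀ b ∈ M, u ∈ a → v ∈ b → s(u, v) ∈ M := by
    intro u v huv a ha b hb hu hv
    have hab := U u v huv a ha b hb (Or.inl hu) (Or.inr hv)
    subst hab
    rwa [← (Sym2.mem_and_mem_iff huv.ne).1 ⟨hu, hv⟩]
  -- two distinct edges at a common vertex cannot both lie in `M`
  have N : ∀ u v w, G.Adj u v → u ≠ w → s(u, v) ∈ M → s(v, w) ∉ M := by
    intro u v w huv huw h1 h2
    have h := U u v huv _ h1 _ h2 (by simp) (by simp)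
    have hu : u ∈ s(v, w) := h ▸ Sym2.mem_mk_left u v
    rcases Sym2.mem_iff.1 hu with h | h
    · exact huv.ne h
    · exact huw h
  have n1 := N x y z hxy hxz.ne
  have n2 := N y x z hxy.symm hyz.ne
  have n3 := N x z y hxz hxy.ne
  rw [Sym2.eq_swap] at n2
  rw [Sym2.eq_swap (a := z)] at n3
  have ex : s(x, y) ∈ M ∨ s(y, z) ∈ M ∨ s(x, z) ∈ M := by
    obtain ⟨f, hf, h | h⟩ := D x y hxy
    · obtain ⟨g, hg, h' | h'⟩ := D y z hyz
      · exact Or.inl (E x y hxy f hf g hg h h')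
      · exact Or.inr (Or.inr (E x z hxz f hf g hg h h'))
    · obtain ⟨g, hg, h' | h'⟩ := D x z hxz
      · exact Or.inl (E x y hxy g hg f hf h' h)
      · exact Or.inr (Or.inl (E y z hyz f hf g hg h h'))
  tauto
end

section
/- If a finite simple graph G has an efficient edge dominating set, then G is K₄-free: there do not exist four pairwise adjacent vertices in G. -/
/-- If a finite simple graph `G` has an efficient edge dominating set,
then `G` has no four pairwise adjacent vertices, i.e. `G` is `K₄`-free. -/
theorem eed_K4_free {V : Type*} [Fintype V] (G : SimpleGraph V)
    (heed : ∃ M : Set (Sym2 V), M ⊆ G.edgeSet ∧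
      ∀ e ∈ G.edgeSet, ∃! f, f ∈ M ∧ ∃ x, x ∈ e ∧ x ∈ f) :
    ¬ ∃ a b c d : V, G.Adj a b ∧ G.Adj a c ∧ G.Adj a d ∧
        G.Adj b c ∧ G.Adj b d ∧ G.Adj c d := by
  obtain ⟨M, -, hM⟩ := heed
  -- two edges of `M` touching a common edge coincide
  have key : ∀ u v f g, G.Adj u v → f ∈ M → g ∈ M → u ∈ f → v ∈ g → f = g := by
    intro u v f g huv hf hg hu hv
    exact (hM s(u, v) huv).unique ⟨hf, u, by simp, hu⟩ ⟨hg, v, by simp, hv⟩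
  have dom : ∀ u v, G.Adj u v → ∃ f ∈ M, u ∈ f ∨ v ∈ f := by
    intro u v huv
    obtain ⟨f, ⟨hf, x, hx, hxf⟩, -⟩ := hM s(u, v) huv
    rcases Sym2.mem_iff.1 hx with rfl | rfl
    · exact ⟨f, hf, Or.inl hxf⟩
    · exact ⟨f, hf, Or.inr hxf⟩
  have three : ∀ (f : Sym2 V) (x y z : V), x ∈ f → y ∈ f → z ∈ f →
      x ≠ y → x ≠ z → y ≠ z → False := by
    intro f x y z
    induction f using Sym2.ind with
    | _ p q =>
      simp only [Sym2.mem_iff]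
      grind
  -- the edges `ab` and `cd` are dominated through `a` and `c`
  have core : ∀ a b c d f g, G.Adj a b → G.Adj a c → G.Adj a d → G.Adj b c → G.Adj b d →
      G.Adj c d → f ∈ M → g ∈ M → a ∈ f → c ∈ g → False := by
    intro a b c d f g hab hac had hbc hbd hcd hf hg ha hc
    obtain rfl := key a c f g hac hf hg ha hc
    obtain ⟨h, hh, hb | hd⟩ := dom b d hbd
    · obtain rfl := key a b f h hab hf hh ha hb
      exact three f a b c ha hb hc hab.ne hac.ne hbc.ne
    · obtain rfl := key a d f h had hf hh ha hd
      exact three f a c d ha hc hd hac.ne had.ne hcd.ne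
  rintro ⟨a, b, c, d, hab, hac, had, hbc, hbd, hcd⟩
  obtain ⟨f, hf, h1⟩ := dom a b hab
  obtain ⟨g, hg, h2⟩ := dom c d hcd
  rcases h1 with h1 | h1 <;> rcases h2 with h2 | h2
  · exact core a b c d f g hab hac had hbc hbd hcd hf hg h1 h2
  · exact core a b d c f g hab had hac hbd hbc hcd.symm hf hg h1 h2
  · exact core b a c d f g hab.symm hbc hbd hac had hcd hf hg h1 h2
  · exact core b a d c f g hab.symm hbd hbc had hac hcd.symm hf hg h1 h2
end

section
/- Let G = (V,E) be a finite simple graph with an efficient edge dominating set M. If distinct vertices a, b, c, d induce a diamond in G (that is, ab, ac, bc, bd, cd ∈ E and ad ∉ E), then the mid-edge bc belongs to M. -/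
theorem eed_adj_eq {V : Type*} (G : SimpleGraph V) (M : Set (Sym2 V))
    (heed : ∀ e ∈ G.edgeSet, ∃! f, f ∈ M ∧ ∃ x, x ∈ e ∧ x ∈ f)
    {x y : V} (h : G.Adj x y) {f g : Sym2 V} (hf : f ∈ M) (hg : g ∈ M)
    (hx : x ∈ f) (hy : y ∈ g) : f = g :=
  (heed s(x, y) h).unique ⟨hf, x, Sym2.mem_mk_left x y, hx⟩ ⟨hg, y, Sym2.mem_mk_right x y, hy⟩

theorem eed_cover {V : Type*} (G : SimpleGraph V) (M : Set (Sym2 V))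
    (heed : ∀ e ∈ G.edgeSet, ∃! f, f ∈ M ∧ ∃ x, x ∈ e ∧ x ∈ f)
    {x y : V} (h : G.Adj x y) : (∃ f ∈ M, x ∈ f) ∨ (∃ f ∈ M, y ∈ f) := by
  obtain ⟨f, ⟨hf, z, hz, hzf⟩, -⟩ := heed s(x, y) h
  rcases Sym2.mem_iff.1 hz with rfl | rfl
  · exact Or.inl ⟨f, hf, hzf⟩
  · exact Or.inr ⟨f, hf, hzf⟩

theorem eed_both {V : Type*} (G : SimpleGraph V) (M : Set (Sym2 V))
    (heed : ∀ e ∈ G.edgeSet, ∃! f, f ∈ M ∧ ∃ x, x ∈ e ∧ x ∈ f)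
    {x y : V} (h : G.Adj x y) (h1 : ∃ f ∈ M, x ∈ f) (h2 : ∃ f ∈ M, y ∈ f) : s(x, y) ∈ M := by
  obtain ⟨f, hf, hx⟩ := h1
  obtain ⟨g, hg, hy⟩ := h2
  obtain rfl := eed_adj_eq G M heed h hf hg hx hy
  rwa [(Sym2.mem_and_mem_iff h.ne).1 ⟨hx, hy⟩] at hf

theorem eed_triangle {V : Type*} (G : SimpleGraph V) (M : Set (Sym2 V))
    (heed : ∀ e ∈ G.edgeSet, ∃! f, f ∈ M ∧ ∃ x, x ∈ e ∧ x ∈ f)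
    {x y z : V} (h1 : G.Adj x y) (h2 : G.Adj x z) (h3 : G.Adj y z) :
    s(x, y) ∈ M ∨ s(x, z) ∈ M ∨ s(y, z) ∈ M := by
  have c1 := eed_cover G M heed h1
  have c2 := eed_cover G M heed h2
  have c3 := eed_cover G M heed h3
  have b1 := eed_both G M heed h1
  have b2 := eed_both G M heed h2
  have b3 := eed_both G M heed h3
  rcases c1 with p | p
  · rcases c3 with q | q
    · exact Or.inl (b1 p q)
    · exact Or.inr (Or.inl (b2 p q))
  · rcases c2 with q | q
    · exact Or.inl (b1 q p)
    · exact Or.inr (Or.inr (b3 p q))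

/-- If `M` is an efficient edge dominating set of a finite simple graph `G`
and distinct vertices `a, b, c, d` induce a diamond (edges `ab, ac, bc, bd, cd`, and
`ad` is not an edge), then the mid-edge `bc` belongs to `M`. -/
theorem eed_diamond_midEdge_mem {V : Type*} [Fintype V] (G : SimpleGraph V)
    (M : Set (Sym2 V)) (hM : M ⊆ G.edgeSet)
    (heed : ∀ e ∈ G.edgeSet, ∃! f, f ∈ M ∧ ∃ x, x ∈ e ∧ x ∈ f)
    (a b c d : V) (had : a ≠ d)
    (hab : G.Adj a b) (hac : G.Adj a c) (hbc : G.Adj b c)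
    (hbd : G.Adj b d) (hcd : G.Adj c d) (hnad : ¬ G.Adj a d) :
    s(b, c) ∈ M := by
  have key : ∀ {x y u v : V}, G.Adj x y → s(x, u) ∈ M → s(y, v) ∈ M → s(x, u) = s(y, v) :=
    fun h hf hg => eed_adj_eq G M heed h hf hg (Sym2.mem_mk_left _ _) (Sym2.mem_mk_left _ _)
  have key2 : ∀ {x y u v : V}, G.Adj x y → s(x, u) ∈ M → s(x, v) ∈ M → s(x, u) = s(x, v) :=
    fun h hf hg => (heed s(_, _) h).unique ⟨hf, _, Sym2.mem_mk_left _ _, Sym2.mem_mk_left _ _⟩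
      ⟨hg, _, Sym2.mem_mk_left _ _, Sym2.mem_mk_left _ _⟩
  have n1 := hab.ne
  have n2 := hac.ne
  have n3 := hbc.ne
  have n4 := hbd.ne
  have n5 := hcd.ne
  rcases eed_triangle G M heed hab hac hbc with h | h | h
  · rw [Sym2.eq_swap] at h
    rcases eed_triangle G M heed hbc hbd hcd with k | k | k
    · exact k
    · have := key2 hbc h k
      grind
    · have := key hbc h k
      grind
  · rw [Sym2.eq_swap] at h
    rcases eed_triangle G M heed hbc hbd hcd with k | k | k
    · exact k
    · have := key hbc.symm h k
      grind
    · have := key2 hbc.symm h k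
      grind
  · exact h
end

section
/- If a finite simple graph G has an efficient edge dominating set, then G is W₄-free and gem-free: G contains no five distinct vertices v₁,v₂,v₃,v₄,u such that u is adjacent to each of v₁,v₂,v₃,v₄ and v₁v₂, v₂v₃, v₃v₄ ∈ E, where either (W₄ case) v₄v₁ ∈ E and v₁v₃, v₂v₄ ∉ E, or (gem case) v₁v₃, v₁v₄, v₂v₄ ∉ E. -/
/-- If a finite simple graph `G` has an efficient edge dominating set,
then `G` is `W₄`-free and gem-free. -/
theorem eed_W4_free_and_gem_free {V : Type*} [Fintype V] (G : SimpleGraph V)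
    (heed : ∃ M : Set (Sym2 V), M ⊆ G.edgeSet ∧
      ∀ e ∈ G.edgeSet, ∃! f, f ∈ M ∧ ∃ x, x ∈ e ∧ x ∈ f) :
    ¬ ∃ v₁ v₂ v₃ v₄ u : V, List.Pairwise (· ≠ ·) [v₁, v₂, v₃, v₄, u] ∧
        G.Adj u v₁ ∧ G.Adj u v₂ ∧ G.Adj u v₃ ∧ G.Adj u v₄ ∧
        G.Adj v₁ v₂ ∧ G.Adj v₂ v₃ ∧ G.Adj v₃ v₄ ∧
        ((G.Adj v₄ v₁ ∧ ¬ G.Adj v₁ v₃ ∧ ¬ G.Adj v₂ v₄) ∨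
          (¬ G.Adj v₁ v₃ ∧ ¬ G.Adj v₁ v₄ ∧ ¬ G.Adj v₂ v₄)) := by
  rintro ⟨v₁, v₂, v₃, v₄, u, hd, h1, h2, h3, h4, h12, h23, h34, -⟩
  obtain ⟨M, -, hM⟩ := heed
  simp only [List.pairwise_cons, List.mem_cons, List.not_mem_nil, or_false,
    forall_eq_or_imp, forall_eq] at hd
  obtain ⟨⟨n12, n13, n14, n1u⟩, ⟨n23, n24, n2u⟩, ⟨n34, n3u⟩, n4u, -⟩ := hd
  have uniq : ∀ a b c d p q : V, G.Adj a b → s(c, d) ∈ M → s(p, q) ∈ M →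
      (a ∈ s(c, d) ∨ b ∈ s(c, d)) → (a ∈ s(p, q) ∨ b ∈ s(p, q)) → s(c, d) = s(p, q) := by
    intro a b c d p q hab hf hg hf' hg'
    refine (hM s(a, b) hab).unique ⟨hf, ?_⟩ ⟨hg, ?_⟩
    · rcases hf' with h | h
      exacts [⟨a, by simp, h⟩, ⟨b, by simp, h⟩]
    · rcases hg' with h | h
      exacts [⟨a, by simp, h⟩, ⟨b, by simp, h⟩]
  -- if both endpoints of an edge are covered by `M`, the edge is in `M`
  have both : ∀ a b f g, G.Adj a b → f ∈ M → g ∈ M → a ∈ f → b ∈ g → s(a, b) ∈ M := by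
    intro a b f g hab hf hg haf hbg
    have e : f = g := (hM s(a, b) hab).unique ⟨hf, a, by simp, haf⟩ ⟨hg, b, by simp, hbg⟩
    subst e
    rwa [← (Sym2.mem_and_mem_iff hab.ne).1 ⟨haf, hbg⟩]
  have cov : ∀ a b, G.Adj a b → (∃ f ∈ M, a ∈ f) ∨ (∃ f ∈ M, b ∈ f) := by
    intro a b hab
    obtain ⟨f, ⟨hf, x, hx, hxf⟩, -⟩ := hM s(a, b) hab
    rcases Sym2.mem_iff.1 hx with rfl | rfl
    exacts [Or.inl ⟨f, hf, hxf⟩, Or.inr ⟨f, hf, hxf⟩]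
  -- every triangle contains an edge of `M`
  have tri : ∀ a b c, G.Adj a b → G.Adj a c → G.Adj b c →
      s(a, b) ∈ M ∨ s(a, c) ∈ M ∨ s(b, c) ∈ M := by
    intro a b c hab hac hbc
    have both' : ∀ x y, G.Adj x y → (∃ f ∈ M, x ∈ f) → (∃ f ∈ M, y ∈ f) → s(x, y) ∈ M := by
      rintro x y hxy ⟨f, hf, hx⟩ ⟨g, hg, hy⟩
      exact both x y f g hxy hf hg hx hy
    rcases cov a b hab with ha | hb
    · rcases cov b c hbc with hb | hc
      · exact Or.inl (both' a b hab ha hb)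
      · exact Or.inr (Or.inl (both' a c hac ha hc))
    · rcases cov a c hac with ha | hc
      · exact Or.inl (both' a b hab ha hb)
      · exact Or.inr (Or.inr (both' b c hbc hb hc))
  -- an edge `u a` of `M` conflicts with any triangle `u b c`
  have key : ∀ a b c, G.Adj u a → G.Adj u b → G.Adj u c → G.Adj b c → a ≠ b → a ≠ c →
      a ≠ u → b ≠ u → c ≠ u → s(u, a) ∉ M := by
    intro a b c ha hb hc hbc nab nac nau nbu ncu h
    rcases tri u b c hb hc hbc with k | k | k
    · have := uniq u a u a u b ha h k (by simp) (by simp)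
      simp at this; grind
    · have := uniq u a u a u c ha h k (by simp) (by simp)
      simp at this; grind
    · have := uniq u b u a b c hb h k (by simp) (by simp)
      simp at this; grind
  have k1 := key v₁ v₃ v₄ h1 h3 h4 h34 n13 n14 n1u n3u n4u
  have k2 := key v₂ v₃ v₄ h2 h3 h4 h34 n23 n24 n2u n3u n4u
  have k3 := key v₃ v₁ v₂ h3 h1 h2 h12 n13.symm n23.symm n3u n1u n2u
  have t1 : s(v₁, v₂) ∈ M := by
    exact ((tri u v₁ v₂ h1 h2 h12).resolve_left k1).resolve_left k2
  have t2 : s(v₂, v₃) ∈ M := by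
    exact ((tri u v₂ v₃ h2 h3 h23).resolve_left k2).resolve_left k3
  have := uniq v₁ v₂ v₁ v₂ v₂ v₃ h12 t1 t2 (by simp) (by simp)
  simp at this
  grind
end

section
/- Let G be a finite simple graph that has an efficient edge dominating set. Then G is chordal if and only if G is dually chordal. -/
/-- The set of vertices coming at or after position `i` in the ordering `σ`. -/
def SimpleGraph.inLater {V : Type*} {n : ℕ} (σ : Fin n ≃ V) (i : Fin n) (x : V) : Prop :=
  ∃ j, i ≤ j ∧ σ j = x

/-- Membership of `x` in the closed neighborhood of `v` inside the subgraph `G_i`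
induced on the vertices at or after position `i`. -/
def SimpleGraph.inClosedNbhd {V : Type*} {n : ℕ} (G : SimpleGraph V) (σ : Fin n ≃ V)
    (i : Fin n) (v x : V) : Prop :=
  SimpleGraph.inLater σ i x ∧ (x = v ∨ G.Adj v x)

/-- `σ` is a maximum neighborhood ordering of `G`: each vertex `v_i` has a maximum
neighbor in `G_i`, i.e. some `m ∈ N_{G_i}[v_i]` with `N_{G_i}[w] ⊆ N_{G_i}[m]` for
all `w ∈ N_{G_i}[v_i]`. -/
def SimpleGraph.IsMaxNbrOrdering {V : Type*} [Fintype V] (G : SimpleGraph V)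
    (σ : Fin (Fintype.card V) ≃ V) : Prop :=
  ∀ i, ∃ m, G.inClosedNbhd σ i (σ i) m ∧
    ∀ w, G.inClosedNbhd σ i (σ i) w →
      ∀ x, G.inClosedNbhd σ i w x → G.inClosedNbhd σ i m x

/-- `G` is dually chordal: it has a maximum neighborhood ordering. -/
def SimpleGraph.DuallyChordal {V : Type*} [Fintype V] (G : SimpleGraph V) : Prop :=
  ∃ σ : Fin (Fintype.card V) ≃ V, G.IsMaxNbrOrdering σ

/-- `G` is chordal: no induced cycle of length at least 4. -/
def SimpleGraph.IsChordal {V : Type*} (G : SimpleGraph V) : Prop :=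
  ∀ k, 4 ≤ k → IsEmpty (SimpleGraph.cycleGraph k ↪g G)

namespace EED

/-- Good vertex predicate relative to a set. -/
def Good {V : Type*} (G : SimpleGraph V) (S : Set V) (v : V) : Prop :=
  ∃ m ∈ S, (m = v ∨ G.Adj v m) ∧
    ∀ w ∈ S, (w = v ∨ G.Adj v w) → ∀ x ∈ S, (x = w ∨ G.Adj w x) → (x = m ∨ G.Adj m x)

theorem cycle_of_walk {V : Type*} (G : SimpleGraph V) (hch : G.IsChordal) (n : ℕ) (hn : 2 ≤ n)
    (f : ℕ → V) (i : V)
    (hf : ∀ s t, s < t → t ≤ n → f s ≠ f t ∧ (G.Adj (f s) (f t) ↔ t = s + 1))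
    (hi : ∀ s, s ≤ n → f s ≠ i ∧ (G.Adj i (f s) ↔ (s = 0 ∨ s = n))) : False := by
  refine (hch (n + 2) (by omega)).false ?_
  have key : ∀ a b : Fin (n + 2), (SimpleGraph.cycleGraph (n + 2)).Adj a b ↔
      (a.val + 1 = b.val ∨ b.val + 1 = a.val ∨ (a.val = 0 ∧ b.val = n + 1) ∨
        (b.val = 0 ∧ a.val = n + 1)) := by
    intro a b
    rw [SimpleGraph.cycleGraph_adj']
    have ha := a.isLt
    have hb := b.isLt
    rw [Fin.val_sub, Fin.val_sub]
    rcases lt_trichotomy a.val b.val with h | h | h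
    · rw [Nat.mod_eq_of_lt (a := n + 2 - b.val + a.val) (by omega),
        Nat.mod_eq_sub_mod (a := n + 2 - a.val + b.val) (by omega), Nat.mod_eq_of_lt (by omega)]
      omega
    · have : a = b := Fin.ext h
      subst this
      simp only [Nat.sub_add_cancel ha.le, Nat.mod_self]
      omega
    · rw [Nat.mod_eq_of_lt (a := n + 2 - a.val + b.val) (by omega),
        Nat.mod_eq_sub_mod (a := n + 2 - b.val + a.val) (by omega), Nat.mod_eq_of_lt (by omega)]
      omega
  let g : Fin (n + 2) → V := fun t => if t.val ≤ n then f t.val else i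
  have hlt : ∀ a b : Fin (n + 2), a.val < b.val → g a ≠ g b ∧
      (G.Adj (g a) (g b) ↔ (a.val + 1 = b.val ∨ (a.val = 0 ∧ b.val = n + 1))) := by
    intro a b hab
    have hb := b.isLt
    have ha' : a.val ≤ n := by omega
    by_cases hbn : b.val ≤ n
    · have := hf a.val b.val hab hbn
      simp only [g, ha', hbn, if_true]
      refine ⟨this.1, this.2.trans ?_⟩
      omega
    · have := hi a.val ha'
      simp only [g, ha', hbn, if_true, if_false]
      refine ⟨this.1, (G.adj_comm _ _).trans (this.2.trans ?_)⟩
      omega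
  refine ⟨⟨g, ?_⟩, ?_⟩
  · intro a b hab
    rcases lt_trichotomy a.val b.val with h | h | h
    · exact absurd hab (hlt a b h).1
    · exact Fin.ext h
    · exact absurd hab.symm (hlt b a h).1
  · intro a b
    show G.Adj (g a) (g b) ↔ _
    rw [key]
    rcases lt_trichotomy a.val b.val with h | h | h
    · rw [(hlt a b h).2]; omega
    · have : a = b := Fin.ext h
      subst this
      simp only [SimpleGraph.irrefl, false_iff]
      omega
    · rw [G.adj_comm, (hlt b a h).2]; omega

theorem lemmaA {V : Type*} (G : SimpleGraph V) (I : Set V)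
    (hI : ∀ x ∈ I, ∀ y ∈ I, ¬ G.Adj x y)
    (hJ : ∀ x y z, x ∉ I → y ∉ I → z ∉ I → G.Adj x y → G.Adj x z → y = z)
    (hch : G.IsChordal) (i : V) (hi : i ∈ I) :
    ∀ (n : ℕ) (x y : V) (p : G.Walk x y), p.length = n → G.Adj i x → G.Adj i y →
      i ∉ p.support → x = y ∨ G.Adj x y := by
  intro n
  induction n using Nat.strong_induction_on with
  | _ n ih =>
  intro x y p hp hx hy hip
  by_contra hcon
  push Not at hcon
  obtain ⟨hne, hnadj⟩ := hcon
  have htake : ∀ s, i ∉ (p.take s).support := fun s h => by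
    rw [SimpleGraph.Walk.support_take] at h
    exact hip (List.mem_of_mem_take h)
  have hdrop : ∀ s, i ∉ (p.drop s).support := fun s h => by
    rw [SimpleGraph.Walk.drop_support_eq_support_drop_min] at h
    exact hip (List.mem_of_mem_drop h)
  have hshort : ∀ q : G.Walk x y, i ∉ q.support → n ≤ q.length := by
    intro q hq
    by_contra hlt
    rcases ih q.length (by omega) x y q rfl hx hy hq with h | h
    · exact hne h
    · exact hnadj h
  have hf : ∀ s t, s < t → t ≤ n → p.getVert s ≠ p.getVert t ∧
      (G.Adj (p.getVert s) (p.getVert t) ↔ t = s + 1) := by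
    intro s t hst htn
    have h1 : p.getVert s ≠ p.getVert t := by
      intro heq
      have := hshort ((p.take s).append ((p.drop t).copy heq.symm rfl)) (by
        rw [SimpleGraph.Walk.mem_support_append_iff, SimpleGraph.Walk.support_copy]
        exact not_or.2 ⟨htake s, hdrop t⟩)
      simp [SimpleGraph.Walk.length_append, SimpleGraph.Walk.take_length,
        SimpleGraph.Walk.drop_length] at this
      omega
    refine ⟨h1, ?_, ?_⟩
    · intro hadj
      have := hshort ((p.take s).append (SimpleGraph.Walk.cons hadj (p.drop t))) (by
        rw [SimpleGraph.Walk.mem_support_append_iff, SimpleGraph.Walk.support_cons,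
          List.mem_cons]
        refine not_or.2 ⟨htake s, not_or.2 ⟨?_, hdrop t⟩⟩
        intro h
        exact hip (h ▸ p.getVert_mem_support s))
      simp [SimpleGraph.Walk.length_append, SimpleGraph.Walk.take_length,
        SimpleGraph.Walk.drop_length] at this
      omega
    · rintro rfl
      exact p.adj_getVert_succ (by omega)
  have h0 : p.getVert 0 = x := p.getVert_zero
  have hl : p.getVert n = y := hp ▸ p.getVert_length
  have hn : 2 ≤ n := by
    by_contra hlt
    have : n = 0 ∨ n = 1 := by omega
    rcases this with rfl | rfl
    · exact hne (h0.symm.trans hl)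
    · apply hnadj
      have := (hf 0 1 (by omega) (by omega)).2.2 rfl
      rwa [h0, hl] at this
  refine cycle_of_walk G hch n hn p.getVert i hf ?_
  intro s hs
  refine ⟨fun h => hip (h ▸ p.getVert_mem_support s), ?_, ?_⟩
  · intro hadj
    by_contra hc
    have hs0 : 0 < s := by omega
    have hsn : s < n := by omega
    have e1 := ih s hsn x (p.getVert s) (p.take s)
      (by simp [SimpleGraph.Walk.take_length]; omega) hx hadj (htake s)
    have e2 := ih (n - s) (by omega) (p.getVert s) y (p.drop s)
      (by simp [SimpleGraph.Walk.drop_length]; omega) hadj hy (hdrop s)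
    have n1 := (hf 0 s hs0 hs).1
    have n2 := (hf s n hsn le_rfl).1
    rw [h0] at n1
    rw [hl] at n2
    have a1 := e1.resolve_left n1
    have a2 := e2.resolve_left n2
    exact hne (hJ (p.getVert s) x y (fun h => hI _ hi _ h hadj) (fun h => hI _ hi _ h hx)
      (fun h => hI _ hi _ h hy) a1.symm a2)
  · rintro (rfl | rfl)
    · rwa [h0]
    · rwa [hl]

theorem pend {V : Type*} (G : SimpleGraph V) (v m : V) (hm : m = v ∨ G.Adj v m)
    (h : ∀ w, G.Adj v w → w = m) : Good G Set.univ v := by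
  refine ⟨m, trivial, hm, ?_⟩
  intro w _ hw x _ hx
  have := G.adj_comm
  grind

theorem exists_good {V : Type*} [Finite V] [Nonempty V] (G : SimpleGraph V) (I : Set V)
    (hI : ∀ x ∈ I, ∀ y ∈ I, ¬ G.Adj x y)
    (hJ : ∀ x y z, x ∉ I → y ∉ I → z ∉ I → G.Adj x y → G.Adj x z → y = z)
    (hch : G.IsChordal) : ∃ v, Good G Set.univ v := by
  by_cases hex : ∃ q : V × V, q.1 ∈ I ∧ G.Adj q.1 q.2
  swap
  · obtain ⟨v⟩ := ‹Nonempty V›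
    have hno : ∀ x y, G.Adj x y → x ∉ I := fun x y h hx => hex ⟨(x, y), hx, h⟩
    refine ⟨v, ?_⟩
    by_cases hw : ∃ w, G.Adj v w
    · obtain ⟨w, hw⟩ := hw
      exact pend G v w (Or.inr hw) fun u hu =>
        hJ v u w (hno _ _ hw) (hno _ _ hu.symm) (hno _ _ hw.symm) hu hw
    · exact pend G v v (Or.inl rfl) fun u hu => absurd ⟨u, hu⟩ hw
  let C : V → V → Set V := fun i a => {z | ∃ p : G.Walk a z, i ∉ p.support}
  obtain ⟨⟨i, a⟩, ⟨hi, hia⟩, hmin⟩ := exists_minimalFor_of_wellFoundedLT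
    (fun q : V × V => q.1 ∈ I ∧ G.Adj q.1 q.2) (fun q => (C q.1 q.2).ncard) hex
  simp only at hi hia
  have hmin' : ∀ j x, j ∈ I → G.Adj j x → (C i a).ncard ≤ (C j x).ncard := by
    intro j x hj hx
    by_contra hlt
    have := hmin (j := (j, x)) ⟨hj, hx⟩ (by simp only; omega)
    simp only at this
    omega
  have hcl : ∀ z y, z ∈ C i a → G.Adj z y → y ≠ i → y ∈ C i a := by
    rintro z y ⟨p, hp⟩ hzy hy
    refine ⟨p.concat hzy, ?_⟩
    rw [SimpleGraph.Walk.support_concat]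
    simp [hp, Ne.symm hy]
  have haC : a ∈ C i a := ⟨SimpleGraph.Walk.nil, by simpa using hia.ne⟩
  have haI : a ∉ I := fun h => hI _ hi _ h hia
  by_cases hCI : ∃ j, j ∈ C i a ∧ j ∈ I
  · have hclq : ∀ j, j ∈ C i a → j ∈ I → ∀ x, G.Adj j x →
        ∃ p : G.Walk x i, j ∉ p.support := by
      intro j hjC hjI x hjx
      by_contra hno
      have hxC : x ∈ C i a := hcl j x hjC hjx (fun h => hI _ hjI _ (h ▸ hi) hjx)
      have hss : C j x ⊂ C i a := by
        refine ⟨?_, ?_⟩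
        · rintro z ⟨p, hp⟩
          obtain ⟨q, hq⟩ := hxC
          refine ⟨q.append p, ?_⟩
          rw [SimpleGraph.Walk.mem_support_append_iff]
          refine not_or.2 ⟨hq, fun hip => hno ?_⟩
          classical
          exact ⟨p.takeUntil i hip, fun h => hp (p.support_takeUntil_subset_support hip h)⟩
        · intro h
          obtain ⟨p, hp⟩ := h hjC
          exact hp p.end_mem_support
      have := Set.ncard_lt_ncard hss (Set.toFinite _)
      have := hmin' j x hjI hjx
      omega
    have hadj : ∀ j, j ∈ C i a → j ∈ I → ∀ x y, G.Adj j x → G.Adj j y → x = y ∨ G.Adj x y := by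
      intro j hjC hjI x y hx hy
      obtain ⟨p, hp⟩ := hclq j hjC hjI x hx
      obtain ⟨q, hq⟩ := hclq j hjC hjI y hy
      refine lemmaA G I hI hJ hch j hjI _ x y (p.append q.reverse) rfl hx hy ?_
      rw [SimpleGraph.Walk.mem_support_append_iff, SimpleGraph.Walk.support_reverse]
      simp [hp, hq]
    by_cases hone : ∃ j ∈ C i a, j ∈ I ∧ ∃ m, (m = j ∨ G.Adj j m) ∧ ∀ w, G.Adj j w → w = m
    · obtain ⟨j, _, _, m, hm, h⟩ := hone
      exact ⟨j, pend G j m hm h⟩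
    have htwo : ∀ j ∈ C i a, j ∈ I → ∀ x, G.Adj j x → ∃ y, G.Adj j y ∧ G.Adj x y := by
      intro j hjC hjI x hx
      by_contra hno
      refine hone ⟨j, hjC, hjI, x, Or.inr hx, fun w hw => ?_⟩
      by_contra hne
      exact hno ⟨w, hw, (hadj j hjC hjI w x hw hx).resolve_left hne |>.symm⟩
    obtain ⟨j, hjC, hjI⟩ := hCI
    -- general finishing statement
    have fin : ∀ b c, G.Adj j b → G.Adj j c → G.Adj b c → (G.Adj i c → G.Adj i b) →
        Good G Set.univ j := by
      intro b c hb hc hbc himp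
      have nI : ∀ k ∈ I, ∀ x, G.Adj k x → x ∉ I := fun k hk x hx h => hI _ hk _ h hx
      have hbI := nI j hjI b hb
      have hcI := nI j hjI c hc
      have hcC : c ∈ C i a := hcl j c hjC hc (fun h => hcI (h ▸ hi))
      refine ⟨b, trivial, Or.inr hb, ?_⟩
      intro w _ hw x _ hx
      -- nbrs of j
      have hjn : ∀ x, G.Adj j x → x = b ∨ x = c := by
        intro x hx
        rcases hadj j hjC hjI x b hx hb with h | h
        · exact Or.inl h
        · exact Or.inr (hJ b x c hbI (nI j hjI x hx) hcI h.symm hbc)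
      have hcn : ∀ x, G.Adj c x → x = b ∨ G.Adj b x := by
        intro x hx
        by_cases hxI : x ∈ I
        · right
          by_cases hxi : x = i
          · subst hxi
            exact (himp hx.symm).symm
          · obtain ⟨y, hy1, hy2⟩ := htwo x (hcl c x hcC hx hxi) hxI c hx.symm
            have : y = b := hJ c y b hcI (nI x hxI y hy1) hbI hy2 hbc.symm
            subst this
            exact hy1.symm
        · exact Or.inl (hJ c x b hcI hxI hbI hx hbc.symm)
      rcases hw with rfl | hw
      · rcases hx with rfl | hx
        · exact Or.inr hb.symm
        · rcases hjn x hx with rfl | rfl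
          · exact Or.inl rfl
          · exact Or.inr hbc
      · rcases hjn w hw with rfl | rfl
        · exact hx
        · rcases hx with rfl | hx
          · exact Or.inr hbc
          · exact hcn x hx
    refine ⟨j, ?_⟩
    by_cases hnb : ∃ b, G.Adj j b
    · obtain ⟨b, hb⟩ := hnb
      obtain ⟨c, hc, hbc⟩ := htwo j hjC hjI b hb
      by_cases h : G.Adj i b
      · exact fin b c hb hc hbc fun _ => h
      · exact fin c b hc hb hbc.symm fun h' => absurd h' h
    · exact pend G j j (Or.inl rfl) fun w hw => absurd ⟨w, hw⟩ hnb
  · have hCJ : ∀ z ∈ C i a, z ∉ I := fun z hz hzI => hCI ⟨z, hz, hzI⟩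
    by_cases hb : ∃ b, G.Adj a b ∧ b ≠ i
    · obtain ⟨b, hab, hbi⟩ := hb
      have hbC := hcl a b haC hab hbi
      have han : ∀ x, G.Adj a x → x = i ∨ x = b := by
        intro x hx
        by_cases hxi : x = i
        · exact Or.inl hxi
        · exact Or.inr (hJ a x b haI (hCJ x (hcl a x haC hx hxi)) (hCJ b hbC) hx hab)
      have hbn : ∀ x, G.Adj b x → x = i ∨ x = a := by
        intro x hx
        by_cases hxi : x = i
        · exact Or.inl hxi
        · exact Or.inr (hJ b x a (hCJ b hbC) (hCJ x (hcl b x hbC hx hxi)) haI hx hab.symm)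
      by_cases hib : G.Adj i b
      · refine ⟨a, i, trivial, Or.inr hia.symm, ?_⟩
        intro w _ hw x _ hx
        grind
      · refine ⟨b, pend G b a (Or.inr hab.symm) fun w hw => ?_⟩
        rcases hbn w hw with rfl | h
        · exact absurd hw.symm hib
        · exact h
    · refine ⟨a, pend G a i (Or.inr hia.symm) fun w hw => ?_⟩
      by_contra h
      exact hb ⟨w, hw, h⟩

theorem exists_good_in {V : Type*} [Finite V] (G : SimpleGraph V) (I : Set V)
    (hI : ∀ x ∈ I, ∀ y ∈ I, ¬ G.Adj x y)
    (hJ : ∀ x y z, x ∉ I → y ∉ I → z ∉ I → G.Adj x y → G.Adj x z → y = z)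
    (hch : G.IsChordal) (S : Set V) (hS : S.Nonempty) : ∃ v ∈ S, Good G S v := by
  have : Nonempty S := hS.to_subtype
  obtain ⟨⟨v, hv⟩, ⟨m, hm⟩, _, h1, h2⟩ := exists_good (G.induce S) {x | x.1 ∈ I}
    (fun x hx y hy h => hI _ hx _ hy h)
    (fun x y z hx hy hz h h' => Subtype.ext (hJ _ _ _ hx hy hz h h'))
    (fun k hk => ⟨fun e => (hch k hk).false (e.trans (SimpleGraph.Embedding.induce S))⟩)
  refine ⟨v, hv, m, hm, by simpa using h1, ?_⟩
  intro w hw hw' x hx hx'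
  simpa using h2 ⟨w, hw⟩ trivial (by simpa using hw') ⟨x, hx⟩ trivial (by simpa using hx')

theorem exists_list {V : Type*} [Finite V] (G : SimpleGraph V)
    (h : ∀ S : Set V, S.Nonempty → ∃ v ∈ S, Good G S v) :
    ∀ (n : ℕ) (S : Set V), S.ncard = n → ∃ l : List V, l.Nodup ∧ (∀ x, x ∈ l ↔ x ∈ S) ∧
      ∀ i (hi : i < l.length), Good G {x | x ∈ l.drop i} l[i] := by
  intro n
  induction n with
  | zero =>
    intro S hS
    have : S = ∅ := (Set.ncard_eq_zero (Set.toFinite S)).1 hS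
    subst this
    exact ⟨[], by simp, by simp, by simp⟩
  | succ n ih =>
    intro S hS
    have hne : S.Nonempty := Set.nonempty_of_ncard_ne_zero (by omega)
    obtain ⟨v, hv, hg⟩ := h S hne
    obtain ⟨l, hl1, hl2, hl3⟩ := ih (S \ {v}) (by
      rw [Set.ncard_sdiff_singleton_of_mem hv, hS]; rfl)
    have hmem : ∀ x, x ∈ v :: l ↔ x ∈ S := by
      intro x
      rw [List.mem_cons, hl2]
      by_cases hx : x = v
      · simp [hx, hv]
      · simp [hx]
    refine ⟨v :: l, List.nodup_cons.2 ⟨by simp [hl2], hl1⟩, hmem, ?_⟩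
    intro i hi
    cases i with
    | zero =>
      have : {x | x ∈ (v :: l).drop 0} = S := by
        ext x; exact hmem x
      rw [this]
      exact hg
    | succ i =>
      simpa using hl3 i (by simpa using hi)

theorem forward {V : Type*} [Fintype V] (G : SimpleGraph V)
    (h : ∀ S : Set V, S.Nonempty → ∃ v ∈ S, Good G S v) : G.DuallyChordal := by
  classical
  obtain ⟨l, hnd, hmem, hg⟩ := exists_list G h _ Set.univ rfl
  have hmem' : ∀ x, x ∈ l := fun x => (hmem x).2 trivial
  let e := hnd.getEquivOfForallMemList l hmem'
  have hlen : l.length = Fintype.card V := by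
    simpa using Fintype.card_congr e
  let σ : Fin (Fintype.card V) ≃ V := (finCongr hlen.symm).trans e
  have hσ : ∀ i, σ i = l[i.val]'(by have := i.isLt; omega) := fun i => rfl
  have hlater : ∀ i x, SimpleGraph.inLater σ i x ↔ x ∈ l.drop i.val := by
    intro i x
    constructor
    · rintro ⟨j, hij, rfl⟩
      rw [hσ, List.mem_drop_iff_getElem]
      have := j.isLt
      have hij' : i.val ≤ j.val := hij
      refine ⟨j.val - i.val, by omega, ?_⟩
      congr 1
      omega
    · intro hx
      rw [List.mem_drop_iff_getElem] at hx
      obtain ⟨j, hj, rfl⟩ := hx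
      exact ⟨⟨i.val + j, by omega⟩, Fin.le_def.2 (by simp), rfl⟩
  refine ⟨σ, fun i => ?_⟩
  obtain ⟨m, hm, h1, h2⟩ := hg i.val (by have := i.isLt; omega)
  refine ⟨m, ⟨(hlater _ _).2 hm, h1⟩, ?_⟩
  rintro w ⟨hw, hw'⟩ x ⟨hx, hx'⟩
  exact ⟨hx, h2 w ((hlater _ _).1 hw) hw' x ((hlater _ _).1 hx) hx'⟩

theorem backward {V : Type*} [Fintype V] (G : SimpleGraph V) (I : Set V)
    (hI : ∀ x ∈ I, ∀ y ∈ I, ¬ G.Adj x y)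
    (hJ : ∀ x y z, x ∉ I → y ∉ I → z ∉ I → G.Adj x y → G.Adj x z → y = z)
    (h : G.DuallyChordal) : G.IsChordal := by
  obtain ⟨σ, hσ⟩ := h
  intro k hk
  obtain ⟨n, rfl⟩ : ∃ n, k = n + 4 := ⟨k - 4, by omega⟩
  refine ⟨fun f => ?_⟩
  obtain ⟨c, hc⟩ := Finite.exists_min (fun c => σ.symm (f c))
  have hlater : ∀ d, SimpleGraph.inLater σ (σ.symm (f c)) (f d) :=
    fun d => ⟨σ.symm (f d), hc d, by simp⟩
  obtain ⟨m, ⟨-, hm0⟩, hm⟩ := hσ (σ.symm (f c))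
  simp only [Equiv.apply_symm_apply] at hm hm0
  have hzero : (0 : Fin (n + 4)).val = 0 := rfl
  have hone : (1 : Fin (n + 4)).val = 1 := by simp
  have htwo : (2 : Fin (n + 4)).val = 2 :=
    Nat.mod_eq_of_lt (show 2 < n + 4 by omega)
  have hthree : (3 : Fin (n + 4)).val = 3 :=
    Nat.mod_eq_of_lt (show 3 < n + 4 by omega)
  have g1 : (1 : Fin (n + 4)) ≠ 0 := by simp
  have g2 : (2 : Fin (n + 4)) ≠ 0 := fun h => by
    have := congrArg Fin.val h
    simp only [hzero, hone, htwo] at this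
    omega
  have g3 : (3 : Fin (n + 4)) ≠ 0 := fun h => by
    have := congrArg Fin.val h
    simp only [hzero, hone, hthree] at this
    omega
  have g21 : (2 : Fin (n + 4)) ≠ 1 := fun h => by
    have := congrArg Fin.val h
    simp only [hzero, hone, htwo] at this
    omega
  have g31 : (3 : Fin (n + 4)) ≠ 1 := fun h => by
    have := congrArg Fin.val h
    simp only [hzero, hone, hthree] at this
    omega
  have hA : ∀ a b, G.Adj (f a) (f b) ↔ (a - b = 1 ∨ b - a = 1) := by
    intro a b
    rw [f.map_adj_iff, SimpleGraph.cycleGraph_adj]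
  have e12 : (1 : Fin (n + 4)) + 1 = 2 := Fin.ext (by
    rw [Fin.val_add, hone, htwo]
    exact Nat.mod_eq_of_lt (by omega))
  have e13 : (1 : Fin (n + 4)) + 2 = 3 := Fin.ext (by
    rw [Fin.val_add, hone, htwo, hthree]
    exact Nat.mod_eq_of_lt (by omega))
  have a1 : G.Adj (f c) (f (c + 1)) := (hA _ _).2 (Or.inr (by abel))
  have a2 : G.Adj (f (c + 1)) (f (c + 2)) := (hA _ _).2 (Or.inr (by rw [← e12]; abel))
  have a3 : G.Adj (f c) (f (c - 1)) := (hA _ _).2 (Or.inl (by abel))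
  have b1 : ¬ G.Adj (f c) (f (c + 2)) := by
    rw [hA]
    rintro (h | h)
    · have : (3 : Fin (n + 4)) = 0 := by
        rw [← e13, ← h]; abel
      exact g3 this
    · apply g21
      rw [← h]; abel
  have b2 : ¬ G.Adj (f (c + 1)) (f (c - 1)) := by
    rw [hA]
    rintro (h | h)
    · apply g21
      rw [← h, ← e12]; abel
    · have : (3 : Fin (n + 4)) = 0 := by
        rw [← e13, ← e12]; nth_rewrite 1 [← h]; abel
      exact g3 this
  have d1 : f c ≠ f (c + 2) := fun h => g2 (by simpa using f.injective h)
  have d2 : f (c + 1) ≠ f (c - 1) := by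
    intro h
    have h := f.injective h
    apply g2
    have : (c + 1) - (c - 1) = 0 := by rw [h]; abel
    rw [← this, ← e12]; abel
  have m2 := (hm _ ⟨hlater (c + 1), Or.inr a1⟩ _ ⟨hlater (c + 2), Or.inr a2⟩).2
  have m1 := (hm _ ⟨hlater c, Or.inl rfl⟩ _ ⟨hlater (c + 1), Or.inr a1⟩).2
  have m3 := (hm _ ⟨hlater c, Or.inl rfl⟩ _ ⟨hlater (c - 1), Or.inr a3⟩).2
  have m0 := (hm _ ⟨hlater c, Or.inl rfl⟩ _ ⟨hlater c, Or.inl rfl⟩).2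
  generalize f (c + 1) = x at *
  generalize f (c + 2) = x' at *
  generalize f (c - 1) = y at *
  generalize f c = v at *
  have n0 : m ≠ v := by
    rintro rfl
    exact m2.elim (fun h => d1 h.symm) b1
  have n1 : m ≠ x := by
    rintro rfl
    exact m3.elim (fun h => d2 h.symm) b2
  have n2 : m ≠ x' := by
    rintro rfl
    exact m0.elim d1 (fun h => b1 h.symm)
  have n3 : m ≠ y := by
    rintro rfl
    exact m1.elim d2 (fun h => b2 h.symm)
  have m0 := m0.resolve_left n0.symm
  have m1 := m1.resolve_left n1.symm
  have m2 := m2.resolve_left n2.symm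
  have m3 := m3.resolve_left n3.symm
  by_cases hmI : m ∈ I
  · have nI : ∀ x, G.Adj m x → x ∉ I := fun x hx h => hI _ hmI _ h hx
    exact d1 (hJ x v x' (nI _ m1) (nI _ m0) (nI _ m2) a1.symm a2)
  · -- at most one nbr of m is outside I
    by_cases hv : v ∈ I
    · have hx : x ∉ I := fun h => hI _ hv _ h a1
      have hy : y ∉ I := fun h => hI _ hv _ h a3
      exact d2 (hJ m x y hmI hx hy m1 m3)
    · by_cases hx : x ∈ I
      · have hx' : x' ∉ I := fun h => hI _ hx _ h a2
        exact d1 (hJ m v x' hmI hv hx' m0 m2)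
      · exact a1.ne (hJ m v x hmI hv hx m0 m1)

end EED

/-- A finite simple graph having an efficient edge dominating set is
chordal if and only if it is dually chordal. -/
theorem eed_chordal_iff_duallyChordal {V : Type*} [Fintype V] (G : SimpleGraph V)
    (heed : ∃ M : Set (Sym2 V), M ⊆ G.edgeSet ∧
      ∀ e ∈ G.edgeSet, ∃! f, f ∈ M ∧ ∃ x, x ∈ e ∧ x ∈ f) :
    G.IsChordal ↔ G.DuallyChordal := by
  obtain ⟨M, hM, h⟩ := heed
  have hI : ∀ x ∈ {x : V | ∀ f ∈ M, x ∉ f}, ∀ y ∈ {x : V | ∀ f ∈ M, x ∉ f}, ¬ G.Adj x y := by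
    intro x hx y hy hxy
    obtain ⟨f, ⟨hf, z, hz, hzf⟩, -⟩ := h s(x, y) hxy
    rcases Sym2.mem_iff.1 hz with rfl | rfl
    · exact hx f hf hzf
    · exact hy f hf hzf
  have hJ : ∀ x y z, x ∉ {x : V | ∀ f ∈ M, x ∉ f} → y ∉ {x : V | ∀ f ∈ M, x ∉ f} →
      z ∉ {x : V | ∀ f ∈ M, x ∉ f} → G.Adj x y → G.Adj x z → y = z := by
    intro x y z hx hy hz hxy hxz
    simp only [Set.mem_ofPred_eq, not_forall, not_not] at hx hy hz
    obtain ⟨f, hf, hxf⟩ := hx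
    obtain ⟨f', hf', hyf⟩ := hy
    obtain ⟨f'', hf'', hzf⟩ := hz
    have e1 : f = f' := (h s(x, y) hxy).unique ⟨hf, x, by simp, hxf⟩ ⟨hf', y, by simp, hyf⟩
    have e2 : f = f'' := (h s(x, z) hxz).unique ⟨hf, x, by simp, hxf⟩ ⟨hf'', z, by simp, hzf⟩
    subst e1
    subst e2
    have h1 := (Sym2.mem_and_mem_iff hxy.ne).1 ⟨hxf, hyf⟩
    have h2 := (Sym2.mem_and_mem_iff hxz.ne).1 ⟨hxf, hzf⟩
    exact Sym2.congr_right.1 (h1.symm.trans h2)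
  exact ⟨fun hch => EED.forward G (EED.exists_good_in G _ hI hJ hch),
    EED.backward G _ hI hJ⟩
end

section
/- Let G = (V,E) be a finite simple graph with a maximum neighborhood ordering v₁,…,vₙ, where for each i < n a maximum neighbor m_i of v_i in G_i is chosen with m_i ≠ v_i. Then for all 1 ≤ i < j ≤ n: v_i and v_j are adjacent in the square G² if and only if v_j lies in the closed neighborhood N_G[m_i] (i.e., v_j = m_i or m_i v_j ∈ E). -/
/-- Let `G` be a finite simple graph with a maximum neighborhood ordering
`v₁, …, vₙ` where for each `i < n` a maximum neighbor `m_i ≠ v_i` of `v_i` in `G_i` is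
chosen. Then for all `i < j`: `v_i v_j` is an edge of the square `G²` iff
`v_j ∈ N_G[m_i]`. -/
theorem maxNbr_square_adjacency {V : Type*} [Fintype V] (G : SimpleGraph V)
    (σ : Fin (Fintype.card V) ≃ V) (m : Fin (Fintype.card V) → V)
    (hm : ∀ i : Fin (Fintype.card V), (i : ℕ) + 1 < Fintype.card V →
      m i ≠ σ i ∧ G.inClosedNbhd σ i (σ i) (m i) ∧
        ∀ w, G.inClosedNbhd σ i (σ i) w →
          ∀ x, G.inClosedNbhd σ i w x → G.inClosedNbhd σ i (m i) x) :
    ∀ i j : Fin (Fintype.card V), i < j →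
      ((σ i ≠ σ j ∧ (G.Adj (σ i) (σ j) ∨ ∃ u, G.Adj (σ i) u ∧ G.Adj u (σ j))) ↔
        (σ j = m i ∨ G.Adj (m i) (σ j))) := by
  intro i j hij
  have hlt : ∀ k l : Fin (Fintype.card V), k < l → (k : ℕ) + 1 < Fintype.card V := by
    intro k l h
    have h1 := l.isLt
    have h2 : (k : ℕ) < l := h
    omega
  obtain ⟨hne, ⟨hl, hmi⟩, hmax⟩ := hm i (hlt i j hij)
  have hadj : G.Adj (σ i) (m i) := hmi.resolve_left hne
  have hij' : σ i ≠ σ j := fun h => hij.ne (σ.injective h)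
  have hA : G.Adj (σ i) (σ j) → (σ j = m i ∨ G.Adj (m i) (σ j)) := fun h =>
    (hmax (σ j) ⟨⟨j, hij.le, rfl⟩, Or.inr h⟩ (σ j) ⟨⟨j, hij.le, rfl⟩, Or.inl rfl⟩).2
  constructor
  · rintro ⟨-, h | ⟨u, h1, h2⟩⟩
    · exact hA h
    · -- induct on the distance of the common neighbour from the end of the ordering
      have key : ∀ d : ℕ, ∀ k : Fin (Fintype.card V), Fintype.card V - (k : ℕ) ≤ d →
          G.Adj (σ i) (σ k) → G.Adj (σ k) (σ j) → (σ j = m i ∨ G.Adj (m i) (σ j)) := by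
        intro d
        induction d with
        | zero =>
          intro k hk
          have := k.isLt
          omega
        | succ d ih =>
          intro k hk h1 h2
          rcases lt_or_ge k i with hki | hik
          · obtain ⟨hne', ⟨⟨l, hkl, hml⟩, -⟩, hmax'⟩ := hm k (hlt k i hki)
            have hi := (hmax' (σ i) ⟨⟨i, hki.le, rfl⟩, Or.inr h1.symm⟩ (σ i)
              ⟨⟨i, hki.le, rfl⟩, Or.inl rfl⟩).2
            have hj := (hmax' (σ j) ⟨⟨j, (hki.trans hij).le, rfl⟩, Or.inr h2⟩ (σ j)
              ⟨⟨j, (hki.trans hij).le, rfl⟩, Or.inl rfl⟩).2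
            rw [← hml] at hi hj hne'
            rcases hi with hi | hi
            · rw [← hi] at hj
              exact hA (hj.resolve_left hij'.symm)
            · rcases hj with hj | hj
              · rw [← hj] at hi
                exact hA hi.symm
              · refine ih l ?_ hi.symm hj
                have h3 : (k : ℕ) < l :=
                  lt_of_le_of_ne hkl (fun h => hne' (by rw [Fin.ext h]))
                have := l.isLt
                omega
          · exact (hmax (σ k) ⟨⟨k, hik, rfl⟩, Or.inr h1⟩ (σ j) ⟨⟨j, hij.le, rfl⟩, Or.inr h2⟩).2
      obtain ⟨k, rfl⟩ := σ.surjective u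
      exact key _ k le_rfl h1 h2
  · rintro (h | h)
    · exact ⟨hij', Or.inl (h ▸ hadj)⟩
    · exact ⟨hij', Or.inr ⟨m i, hadj, h⟩⟩
end

section
/- Let G = (V,E) be a finite simple graph and M an efficient edge dominating set of G. Then M is an induced matching of G, and moreover M is a maximum induced matching: |M'| ≤ |M| for every induced matching M' of G. -/
/-- `M` is an induced matching of `G`: a set of edges of `G` such that any two distinct
edges of `M` share no endpoint and no edge of `G` joins endpoints of two distinct edges
of `M`. -/
def SimpleGraph.IsInducedMatching {V : Type*} (G : SimpleGraph V) (M : Finset (Sym2 V)) :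
    Prop :=
  ↑M ⊆ G.edgeSet ∧
    ∀ e ∈ M, ∀ f ∈ M, e ≠ f → ∀ x ∈ e, ∀ y ∈ f, x ≠ y ∧ ¬ G.Adj x y

/-- An efficient edge dominating set `M` of a finite simple graph `G` is
an induced matching, and moreover a maximum induced matching. -/
theorem eed_isMaximum_inducedMatching {V : Type*} [Fintype V] (G : SimpleGraph V)
    (M : Finset (Sym2 V)) (hM : ↑M ⊆ G.edgeSet)
    (heed : ∀ e ∈ G.edgeSet, ∃! f, f ∈ M ∧ ∃ x, x ∈ e ∧ x ∈ f) :
    G.IsInducedMatching M ∧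
      ∀ M' : Finset (Sym2 V), G.IsInducedMatching M' → M'.card ≤ M.card := by
  classical
  refine ⟨⟨hM, ?_⟩, ?_⟩
  · intro e he f hf hne x hx y hy
    refine ⟨?_, ?_⟩
    · rintro rfl
      exact hne ((heed e (hM he)).unique ⟨he, x, hx, hx⟩ ⟨hf, x, hx, hy⟩)
    · intro hadj
      exact hne ((heed s(x, y) hadj).unique ⟨he, x, Sym2.mem_mk_left x y, hx⟩
        ⟨hf, y, Sym2.mem_mk_right x y, hy⟩)
  · rintro M' ⟨hM', hind⟩
    have h : ∀ e ∈ M', ∃ f, f ∈ M ∧ ∃ x, x ∈ e ∧ x ∈ f :=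
      fun e he => (heed e (hM' he)).exists
    choose! φ hφ using h
    refine Finset.card_le_card_of_injOn φ (fun e he => (hφ e he).1) ?_
    intro e he f hf hef
    by_contra hne
    obtain ⟨h1, x, hxe, hx⟩ := hφ e he
    obtain ⟨-, y, hyf, hy⟩ := hφ f hf
    rw [← hef] at hy
    obtain ⟨hxy, hnadj⟩ := hind e he f hf hne x hxe y hyf
    have hs : φ e = s(x, y) := (Sym2.mem_and_mem_iff hxy).1 ⟨hx, hy⟩
    have hG := hM h1
    rw [hs] at hG
    exact hnadj hG
end

section
/- For every k ≥ 6, the complement of the chordless cycle C_k has no efficient edge dominating set. -/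
theorem antihole_cycle_adj (k : ℕ) (hk : 6 ≤ k) (u v : Fin k) :
    (SimpleGraph.cycleGraph k).Adj u v ↔
      (u.val + 1 = v.val ∨ v.val + 1 = u.val ∨ (u.val = 0 ∧ v.val + 1 = k) ∨
        (v.val = 0 ∧ u.val + 1 = k)) := by
  rw [SimpleGraph.cycleGraph_adj']
  have hu := u.isLt
  have hv := v.isLt
  have key : ∀ a b : Fin k, (a - b).val = if b.val ≤ a.val then a.val - b.val
      else k + a.val - b.val := by
    intro a b
    have ha := a.isLt
    have hb := b.isLt
    split_ifs with h
    · exact Fin.sub_val_of_le h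
    · rw [Fin.val_sub, Nat.mod_eq_of_lt] <;> omega
  rw [key, key]
  split_ifs <;> omega

/-- For every `k ≥ 6`, the complement of the chordless cycle `C_k` has no
efficient edge dominating set. -/
theorem antihole_no_eed (k : ℕ) (hk : 6 ≤ k) :
    ¬ ∃ M : Set (Sym2 (Fin k)), M ⊆ (SimpleGraph.cycleGraph k)ᶜ.edgeSet ∧
      ∀ e ∈ (SimpleGraph.cycleGraph k)ᶜ.edgeSet,
        ∃! f, f ∈ M ∧ ∃ x, x ∈ e ∧ x ∈ f := by
  rintro ⟨M, hM, hd⟩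
  have adj : ∀ u v : Fin k, s(u, v) ∈ (SimpleGraph.cycleGraph k)ᶜ.edgeSet ↔
      (u.val ≠ v.val ∧ ¬ (u.val + 1 = v.val ∨ v.val + 1 = u.val ∨ (u.val = 0 ∧ v.val + 1 = k) ∨
        (v.val = 0 ∧ u.val + 1 = k))) := by
    intro u v
    rw [SimpleGraph.mem_edgeSet, SimpleGraph.compl_adj, antihole_cycle_adj k hk, ne_eq, Fin.ext_iff]
  -- any two edges of `M` coincide
  have uniq : ∀ f ∈ M, ∀ g ∈ M, f = g := by
    intro f hf g hg
    by_contra hne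
    have no : ∀ x y, x ∈ f → y ∈ g → s(x, y) ∉ (SimpleGraph.cycleGraph k)ᶜ.edgeSet := by
      intro x y hx hy he
      exact hne ((hd _ he).unique ⟨hf, x, by simp, hx⟩ ⟨hg, y, by simp, hy⟩)
    have disj : ∀ x, x ∈ f → x ∉ g := by
      intro x hx hy
      exact hne ((hd _ (hM hf)).unique ⟨hf, x, hx, hx⟩ ⟨hg, x, hx, hy⟩)
    induction f with | _ a b =>
    induction g with | _ c d =>
    have h1 := (adj a b).1 (hM hf)
    have h2 := (adj c d).1 (hM hg)
    have n1 := no a c (by simp) (by simp)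
    have n2 := no a d (by simp) (by simp)
    have n3 := no b c (by simp) (by simp)
    have n4 := no b d (by simp) (by simp)
    have d1 := disj a (by simp)
    have d2 := disj b (by simp)
    rw [adj] at n1 n2 n3 n4
    simp only [Sym2.mem_iff, Fin.ext_iff] at d1 d2
    have := a.isLt
    have := b.isLt
    have := c.isLt
    have := d.isLt
    omega
  -- three disjoint edges
  have e1 := (adj ⟨0, by omega⟩ ⟨2, by omega⟩).2 (by simp; omega)
  have e2 := (adj ⟨1, by omega⟩ ⟨4, by omega⟩).2 (by simp)
  have e3 := (adj ⟨3, by omega⟩ ⟨5, by omega⟩).2 (by simp)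
  obtain ⟨f, ⟨hf, x, hx, hxf⟩, -⟩ := hd _ e1
  obtain ⟨g, ⟨hg, y, hy, hyg⟩, -⟩ := hd _ e2
  obtain ⟨h, ⟨hh, z, hz, hzh⟩, -⟩ := hd _ e3
  rw [uniq g hg f hf] at hyg
  rw [uniq h hh f hf] at hzh
  induction f with | _ a b =>
  simp only [Sym2.mem_iff, Fin.ext_iff] at hx hy hz hxf hyg hzh
  omega
end

section
/- Let G be a finite simple graph that is hole-free (G contains no induced cycle of length at least 5) and has an efficient edge dominating set. Then the complement of G is also hole-free; that is, G is weakly chordal. -/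
/-- `G` is hole-free: it has no induced (chordless) cycle of length at least 5. -/
def SimpleGraph.HoleFree {V : Type*} (G : SimpleGraph V) : Prop :=
  ∀ k, 5 ≤ k → IsEmpty (SimpleGraph.cycleGraph k ↪g G)

theorem eed_no_core {V : Type*} (G : SimpleGraph V) (B : V → Prop)
    (H1 : ∀ u v, G.Adj u v → B u ∨ B v)
    (H2 : ∀ u v w, G.Adj u v → G.Adj u w → v ≠ w → B u → B v → B w → False)
    (k : ℕ) (hk : 6 ≤ k) (φ : SimpleGraph.cycleGraph k ↪g Gᶜ) : False := by
  have adj : ∀ i j : Fin k, i ≠ j → ¬ (SimpleGraph.cycleGraph k).Adj i j →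
      G.Adj (φ i) (φ j) := by
    intro i j hij h
    rw [← φ.map_rel_iff, SimpleGraph.compl_adj] at h
    by_contra h2
    exact h ⟨fun e => hij (φ.injective e), h2⟩
  have ne : ∀ i j : Fin k, i ≠ j → φ i ≠ φ j := fun i j h e => h (φ.injective e)
  have h1 : ∀ i j : Fin k, i ≠ j → ¬ (SimpleGraph.cycleGraph k).Adj i j →
      B (φ i) ∨ B (φ j) := fun i j h h' => H1 _ _ (adj i j h h')
  have h2 : ∀ i j l : Fin k, i ≠ j → ¬ (SimpleGraph.cycleGraph k).Adj i j →
      i ≠ l → ¬ (SimpleGraph.cycleGraph k).Adj i l → j ≠ l →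
      B (φ i) → B (φ j) → B (φ l) → False :=
    fun i j l a b c d e => H2 _ _ _ (adj i j a b) (adj i l c d) (ne j l e)
  clear adj ne
  generalize hC : (fun i => B (φ i)) = C
  have e : ∀ i, B (φ i) = C i := fun i => by rw [← hC]
  simp only [e] at h1 h2
  clear e hC H1 H2 φ
  rcases Nat.lt_or_ge k 8 with hk8 | hk8
  · interval_cases k
    · have a1 := h1 0 2 (by decide) (by decide)
      have a2 := h1 0 4 (by decide) (by decide)
      have a3 := h1 2 4 (by decide) (by decide)
      have b1 := h1 1 3 (by decide) (by decide)
      have b2 := h1 1 5 (by decide) (by decide)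
      have b3 := h1 3 5 (by decide) (by decide)
      have c1 := h2 0 2 4 (by decide) (by decide) (by decide) (by decide) (by decide)
      have c2 := h2 0 2 3 (by decide) (by decide) (by decide) (by decide) (by decide)
      have c3 := h2 2 0 5 (by decide) (by decide) (by decide) (by decide) (by decide)
      have c4 := h2 0 4 3 (by decide) (by decide) (by decide) (by decide) (by decide)
      have c5 := h2 4 0 1 (by decide) (by decide) (by decide) (by decide) (by decide)
      have c6 := h2 2 4 5 (by decide) (by decide) (by decide) (by decide) (by decide)
      have c7 := h2 4 2 1 (by decide) (by decide) (by decide) (by decide) (by decide)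
      clear h1 h2
      grind
    · have b : ∀ i : Fin 7, C i ∨ C (i+2) := fun i =>
        h1 i (i+2) (by revert i; decide) (by revert i; decide)
      have c : ∀ i : Fin 7, C i ∨ C (i+3) := fun i =>
        h1 i (i+3) (by revert i; decide) (by revert i; decide)
      have d : ∀ i : Fin 7, C i → C (i+2) → C (i+4) → False := fun i =>
        h2 i (i+2) (i+4) (by revert i; decide) (by revert i; decide)
         (by revert i; decide) (by revert i; decide) (by revert i; decide)
      have b' : (C 0 ∨ C 2) ∧ (C 1 ∨ C 3) ∧ (C 2 ∨ C 4) ∧ (C 3 ∨ C 5) ∧ (C 4 ∨ C 6) ∧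
        (C 5 ∨ C 0) ∧ (C 6 ∨ C 1) := ⟨b 0, b 1, b 2, b 3, b 4, b 5, b 6⟩
      have c' : (C 0 ∨ C 3) ∧ (C 1 ∨ C 4) ∧ (C 2 ∨ C 5) ∧ (C 3 ∨ C 6) ∧ (C 4 ∨ C 0) ∧
        (C 5 ∨ C 1) ∧ (C 6 ∨ C 2) := ⟨c 0, c 1, c 2, c 3, c 4, c 5, c 6⟩
      have d0 : C 0 → C 2 → C 4 → False := d 0
      have d1 : C 1 → C 3 → C 5 → False := d 1
      have d2 : C 2 → C 4 → C 6 → False := d 2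
      have d3 : C 3 → C 5 → C 0 → False := d 3
      have d4 : C 4 → C 6 → C 1 → False := d 4
      have d5 : C 5 → C 0 → C 2 → False := d 5
      have d6 : C 6 → C 1 → C 3 → False := d 6
      clear b c d h1 h2
      grind
  · have nadj : ∀ a b : ℕ, ∀ ha : a < k, ∀ hb : b < k, a + 1 < b → b < a + k - 1 →
        ¬ (SimpleGraph.cycleGraph k).Adj ⟨a, ha⟩ ⟨b, hb⟩ := by
      intro a b ha hb h h'
      rw [SimpleGraph.cycleGraph_adj']
      rw [Fin.sub_def, Fin.sub_def]
      simp only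
      rw [Nat.mod_eq_of_lt (a := k - b + a) (by omega),
        show k - a + b = (b - a) + k by omega, Nat.add_mod_right, Nat.mod_eq_of_lt (by omega)]
      omega
    have n1 : ∀ a b : ℕ, ∀ ha : a < k, ∀ hb : b < k, a + 1 < b →
        (⟨a, ha⟩ : Fin k) ≠ ⟨b, hb⟩ := by
      intro a b ha hb h h'
      rw [Fin.mk.injEq] at h'
      omega
    have p : ∀ a b : ℕ, ∀ ha : a < k, ∀ hb : b < k, a + 1 < b → b < a + k - 1 →
        C ⟨a, ha⟩ ∨ C ⟨b, hb⟩ := fun a b ha hb h h' =>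
      h1 _ _ (n1 a b ha hb h) (nadj a b ha hb h h')
    have q : ∀ a b c : ℕ, ∀ ha : a < k, ∀ hb : b < k, ∀ hc : c < k, a + 1 < b → b + 1 < c →
        c < a + k - 1 → C ⟨a, ha⟩ → C ⟨b, hb⟩ → C ⟨c, hc⟩ → False :=
      fun a b c ha hb hc h h' h'' =>
      h2 _ _ _ (n1 a b ha hb h) (nadj a b ha hb h (by omega)) (n1 a c ha hc (by omega))
        (nadj a c ha hc (by omega) h'') (n1 b c hb hc h')
    have p1 := p 0 2 (by omega) (by omega) (by omega) (by omega)
    have p2 := p 0 4 (by omega) (by omega) (by omega) (by omega)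
    have p3 := p 0 6 (by omega) (by omega) (by omega) (by omega)
    have p4 := p 2 4 (by omega) (by omega) (by omega) (by omega)
    have p5 := p 2 6 (by omega) (by omega) (by omega) (by omega)
    have p6 := p 4 6 (by omega) (by omega) (by omega) (by omega)
    have q1 := q 0 2 4 (by omega) (by omega) (by omega) (by omega) (by omega) (by omega)
    have q2 := q 0 2 6 (by omega) (by omega) (by omega) (by omega) (by omega) (by omega)
    have q3 := q 0 4 6 (by omega) (by omega) (by omega) (by omega) (by omega) (by omega)
    have q4 := q 2 4 6 (by omega) (by omega) (by omega) (by omega) (by omega) (by omega)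
    clear p q n1 nadj h1 h2
    grind

/-- If a finite simple graph `G` is hole-free and has an efficient edge
dominating set, then its complement is hole-free as well, i.e. `G` is weakly chordal. -/
theorem holeFree_eed_weaklyChordal {V : Type*} [Fintype V] (G : SimpleGraph V)
    (hhf : G.HoleFree)
    (heed : ∃ M : Set (Sym2 V), M ⊆ G.edgeSet ∧
      ∀ e ∈ G.edgeSet, ∃! f, f ∈ M ∧ ∃ x, x ∈ e ∧ x ∈ f) :
    Gᶜ.HoleFree := by
  obtain ⟨M, -, hM⟩ := heed
  have key : ∀ u v, G.Adj u v → (∃ f ∈ M, u ∈ f) → (∃ f ∈ M, v ∈ f) → s(u, v) ∈ M := by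
    rintro u v h ⟨f, hf, huf⟩ ⟨g, hg, hvg⟩
    have := (hM s(u, v) h).unique ⟨hf, u, by simp, huf⟩ ⟨hg, v, by simp, hvg⟩
    subst this
    rwa [← (Sym2.mem_and_mem_iff h.ne).1 ⟨huf, hvg⟩]
  intro k hk
  refine ⟨fun φ => ?_⟩
  rcases Nat.lt_or_ge 5 k with h6 | h5
  · refine eed_no_core G (fun v => ∃ f ∈ M, v ∈ f) ?_ ?_ k h6 φ
    · intro u v h
      obtain ⟨f, ⟨hf, x, hx, hxf⟩, -⟩ := hM s(u, v) h
      rcases Sym2.mem_iff.1 hx with rfl | rfl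
      · exact Or.inl ⟨f, hf, hxf⟩
      · exact Or.inr ⟨f, hf, hxf⟩
    · intro u v w huv huw hvw hu hv hw
      have := (hM s(u, v) huv).unique ⟨key u v huv hu hv, u, by simp, by simp⟩
        ⟨key u w huw hu hw, u, by simp, by simp⟩
      exact hvw (Sym2.congr_right.1 this)
  · obtain rfl : k = 5 := by omega
    refine (hhf 5 le_rfl).false ⟨⟨fun i => φ (2 * i), ?_⟩, ?_⟩
    · intro i j h
      have := φ.injective h
      clear h; revert this; revert i j; decide
    · intro i j
      change G.Adj (φ (2 * i)) (φ (2 * j)) ↔ _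
      have h : (SimpleGraph.cycleGraph 5).Adj i j ↔
          2 * i ≠ 2 * j ∧ ¬ (SimpleGraph.cycleGraph 5).Adj (2 * i) (2 * j) := by
        revert i j; decide
      rw [h, ← φ.map_rel_iff, SimpleGraph.compl_adj, ← φ.injective.ne_iff]
      constructor
      · exact fun h => ⟨h.ne, fun h' => h'.2 h⟩
      · rintro ⟨h, h'⟩
        by_contra h2
        exact h' ⟨h, h2⟩
end

section
/- Let G = (V,E) be a finite simple graph and let F be the graph whose vertex set is the disjoint union V ∪ E ∪ {f,g}, whose edges are: all pairs of distinct elements of E ∪ {f} (so E ∪ {f} is a clique), the pair {f,g}, and for each edge e = xy ∈ E the pairs {e,x} and {e,y}. Let F² be the square of F and let α denote the maximum size of an independent vertex set. Then α(F²) = α(G) + 1. -/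
variable {V : Type*} [Fintype V] [DecidableEq V]

/-- The vertex set of the graph `F`: the vertices of `G`, the edges of `G`, and two
extra vertices `f` (index `0`) and `g` (index `1`). -/
abbrev FVert (G : SimpleGraph V) [DecidableRel G.Adj] : Type _ :=
  V ⊕ ({e : Sym2 V // e ∈ G.edgeFinset} ⊕ Fin 2)

/-- Generating relation for `F`: all pairs of distinct elements of `E ∪ {f}` are
adjacent (`E ∪ {f}` is a clique), `f` is adjacent to `g`, and each edge `e = xy ∈ E`
is adjacent to its endpoints `x` and `y`. -/
def fRel (G : SimpleGraph V) [DecidableRel G.Adj] : FVert G → FVert G → Prop :=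
  fun a b =>
    match a, b with
    | Sum.inl x, Sum.inr (Sum.inl e) => x ∈ e.1
    | Sum.inr (Sum.inl e), Sum.inl x => x ∈ e.1
    | Sum.inr (Sum.inl _), Sum.inr (Sum.inl _) => True
    | Sum.inr (Sum.inl _), Sum.inr (Sum.inr i) => i = 0
    | Sum.inr (Sum.inr i), Sum.inr (Sum.inl _) => i = 0
    | Sum.inr (Sum.inr _), Sum.inr (Sum.inr _) => True
    | _, _ => False

/-- The graph `F` built from `G`. -/
def FGraph (G : SimpleGraph V) [DecidableRel G.Adj] : SimpleGraph (FVert G) :=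
  SimpleGraph.fromRel (fRel G)

/-- The square of a graph: two distinct vertices are adjacent iff they are adjacent or
have a common neighbor. -/
def SimpleGraph.square {W : Type*} (H : SimpleGraph W) : SimpleGraph W :=
  SimpleGraph.fromRel (fun a b => H.Adj a b ∨ ∃ c, H.Adj a c ∧ H.Adj c b)

theorem sq_inl (G : SimpleGraph V) [DecidableRel G.Adj] (x y : V) :
    (FGraph G).square.Adj (Sum.inl x) (Sum.inl y) ↔ G.Adj x y := by
  simp only [SimpleGraph.square, FGraph, SimpleGraph.fromRel_adj]
  constructor
  · rintro ⟨hne, h⟩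
    have hxy : x ≠ y := fun h => hne (by rw [h])
    have key : ∀ e : {e : Sym2 V // e ∈ G.edgeFinset}, x ∈ e.1 → y ∈ e.1 → G.Adj x y := by
      rintro ⟨e, he⟩ hx hy
      have : e = s(x, y) := (Sym2.mem_and_mem_iff hxy).1 ⟨hx, hy⟩
      subst this
      simpa using he
    rcases h with (h | ⟨c, h1, h2⟩) | (h | ⟨c, h1, h2⟩)
    · simp [fRel] at h
    · rcases c with c | e | i <;> simp [fRel] at h1 h2
      exact key e h1 h2
    · simp [fRel] at h
    · rcases c with c | e | i <;> simp [fRel] at h1 h2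
      exact key e h2 h1
  · intro h
    refine ⟨by simpa using h.ne, Or.inl (Or.inr ⟨Sum.inr (Sum.inl ⟨s(x, y), by simpa using h⟩), ?_, ?_⟩)⟩ <;>
      simp [fRel]

theorem sq_inr (G : SimpleGraph V) [DecidableRel G.Adj]
    (x y : {e : Sym2 V // e ∈ G.edgeFinset} ⊕ Fin 2) (hxy : x ≠ y) :
    (FGraph G).square.Adj (Sum.inr x) (Sum.inr y) := by
  simp only [SimpleGraph.square, FGraph, SimpleGraph.fromRel_adj]
  refine ⟨by simpa using hxy, Or.inl ?_⟩
  rcases x with e | i <;> rcases y with e' | j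
  · left; simpa [fRel] using hxy
  · fin_cases j
    · left; simp [fRel]
    · right; exact ⟨Sum.inr (Sum.inr 0), by simp [fRel], by simp [fRel]⟩
  · fin_cases i
    · left; simp [fRel]
    · right; exact ⟨Sum.inr (Sum.inr 0), by simp [fRel], by simp [fRel]⟩
  · left; simpa [fRel] using hxy

theorem sq_g (G : SimpleGraph V) [DecidableRel G.Adj] (x : V) :
    ¬ (FGraph G).square.Adj (Sum.inl x) (Sum.inr (Sum.inr 1)) := by
  simp only [SimpleGraph.square, FGraph, SimpleGraph.fromRel_adj]
  rintro ⟨-, (h | ⟨c, h1, h2⟩) | (h | ⟨c, h1, h2⟩)⟩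
  · simp [fRel] at h
  · rcases c with c | e | i <;> simp [fRel] at h1 h2
  · simp [fRel] at h
  · rcases c with c | e | i <;> simp [fRel] at h1 h2

/-- With `F` as above, the maximum size of an independent set of the
square `F²` equals `α(G) + 1`. -/
theorem alpha_Fsquare_eq_alpha_add_one (G : SimpleGraph V) [DecidableRel G.Adj] (a : ℕ)
    (ha : IsGreatest
      {n | ∃ s : Finset V, (∀ x ∈ s, ∀ y ∈ s, x ≠ y → ¬ G.Adj x y) ∧ s.card = n} a) :
    IsGreatest
      {n | ∃ t : Finset (FVert G),
        (∀ x ∈ t, ∀ y ∈ t, x ≠ y → ¬ (FGraph G).square.Adj x y) ∧ t.card = n}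
      (a + 1) := by
  obtain ⟨⟨s, hs, hc⟩, hmax⟩ := ha
  constructor
  · refine ⟨s.disjSum {Sum.inr 1}, ?_, by simp [hc]⟩
    rintro (x | x) hx (y | y) hy hne hadj
    · rw [sq_inl] at hadj
      exact hs x (by simpa using hx) y (by simpa using hy) hadj.ne hadj
    · have : y = Sum.inr 1 := by simpa using hy
      subst this
      exact sq_g G x hadj
    · have : x = Sum.inr 1 := by simpa using hx
      subst this
      exact sq_g G y hadj.symm
    · have h1 : x = Sum.inr 1 := by simpa using hx
      have h2 : y = Sum.inr 1 := by simpa using hy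
      exact hne (by rw [h1, h2])
  · rintro n ⟨t, ht, rfl⟩
    rw [← Finset.card_toLeft_add_card_toRight (u := t)]
    refine Nat.add_le_add (hmax ⟨t.toLeft, ?_, rfl⟩) ?_
    · intro x hx y hy hne hadj
      exact ht _ (Finset.mem_toLeft.1 hx) _ (Finset.mem_toLeft.1 hy) (by simpa using hne)
        ((sq_inl G x y).2 hadj)
    · rw [Finset.card_le_one]
      intro x hx y hy
      by_contra hne
      exact ht _ (Finset.mem_toRight.1 hx) _ (Finset.mem_toRight.1 hy) (by simpa using hne)
        (sq_inr G x y hne)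
end

section
/- Let H = (V, 𝓔) be a finite hypergraph, let u and v be two new vertices not in V, and let H' be the hypergraph with vertex set V ∪ {u,v} and hyperedge family 𝓔 ∪ {V ∪ {u}, {u,v}}. Then H has an exact cover if and only if H' has an exact cover. -/
/-- `C` is an exact cover of the hypergraph with hyperedge family `𝓔` on the (finite)
vertex type `α`: `C ⊆ 𝓔`, the members of `C` are pairwise disjoint, and every vertex
belongs to a member of `C`. -/
def IsExactCover {α : Type*} [DecidableEq α] (𝓔 : Finset (Finset α))
    (C : Finset (Finset α)) : Prop :=
  C ⊆ 𝓔 ∧ (∀ e ∈ C, ∀ f ∈ C, e ≠ f → Disjoint e f) ∧ ∀ x : α, ∃ e ∈ C, x ∈ e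

/-- Let `H = (V, 𝓔)` be a finite hypergraph, let `u, v` be two new
vertices (here `u = Sum.inr 0` and `v = Sum.inr 1` in `V ⊕ Fin 2`), and let `H'` have
vertex set `V ∪ {u, v}` and hyperedge family `𝓔 ∪ {V ∪ {u}, {u, v}}`. Then `H` has an
exact cover iff `H'` has an exact cover. -/
theorem exactCover_iff_extended {V : Type*} [Fintype V] [DecidableEq V]
    (𝓔 : Finset (Finset V)) :
    (∃ C, IsExactCover 𝓔 C) ↔
      (∃ C', IsExactCover
        (𝓔.image (fun e => e.map ⟨Sum.inl, Sum.inl_injective⟩) ∪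
          {insert (Sum.inr 0) ((Finset.univ : Finset V).map ⟨Sum.inl, Sum.inl_injective⟩),
            ({Sum.inr 0, Sum.inr 1} : Finset (V ⊕ Fin 2))})
        C') := by
  classical
  constructor
  · rintro ⟨C, hC, hd, hc⟩
    refine ⟨insert {Sum.inr 0, Sum.inr 1}
      (C.image (fun e => e.map ⟨Sum.inl, Sum.inl_injective⟩)), ?_, ?_, ?_⟩
    · intro e he
      rcases Finset.mem_insert.1 he with rfl | he
      · simp
      · exact Finset.mem_union_left _ (Finset.image_subset_image hC he)
    · intro e he f hf hne
      rcases Finset.mem_insert.1 he with rfl | he <;>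
        rcases Finset.mem_insert.1 hf with rfl | hf
      · exact absurd rfl hne
      · obtain ⟨f, hf, rfl⟩ := Finset.mem_image.1 hf
        simp
      · obtain ⟨e, he, rfl⟩ := Finset.mem_image.1 he
        simp
      · obtain ⟨a, ha, rfl⟩ := Finset.mem_image.1 he
        obtain ⟨b, hb, rfl⟩ := Finset.mem_image.1 hf
        refine (Finset.disjoint_map _).2 (hd a ha b hb ?_)
        rintro rfl
        exact hne rfl
    · rintro (x | i)
      · obtain ⟨e, he, hx⟩ := hc x
        exact ⟨_, Finset.mem_insert_of_mem (Finset.mem_image_of_mem _ he), by simpa using hx⟩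
      · refine ⟨_, Finset.mem_insert_self _ _, ?_⟩
        fin_cases i <;> simp
  · rintro ⟨C', hC, hd, hc⟩
    have huv : ({Sum.inr 0, Sum.inr 1} : Finset (V ⊕ Fin 2)) ∈ C' := by
      obtain ⟨e, he, hx⟩ := hc (Sum.inr 1)
      have h := hC he
      simp only [Finset.mem_union, Finset.mem_image, Finset.mem_insert,
        Finset.mem_singleton] at h
      rcases h with ⟨a, _, rfl⟩ | rfl | rfl
      · simp at hx
      · simp at hx
      · exact he
    refine ⟨𝓔.filter (fun e => e.map ⟨Sum.inl, Sum.inl_injective⟩ ∈ C'),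
      Finset.filter_subset _ _, ?_, ?_⟩
    · intro e he f hf hne
      refine (Finset.disjoint_map _).1 (hd _ (Finset.mem_filter.1 he).2 _
        (Finset.mem_filter.1 hf).2 ?_)
      exact fun h => hne (Finset.map_injective _ h)
    · intro x
      obtain ⟨e, he, hx⟩ := hc (Sum.inl x)
      have h := hC he
      simp only [Finset.mem_union, Finset.mem_image, Finset.mem_insert,
        Finset.mem_singleton] at h
      rcases h with ⟨a, ha, rfl⟩ | rfl | rfl
      · exact ⟨a, Finset.mem_filter.2 ⟨ha, he⟩, by simpa using hx⟩
      · exfalso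
        have hdis := hd _ he _ huv (fun h => by rw [h] at hx; simp at hx)
        exact Finset.disjoint_left.1 hdis (Finset.mem_insert_self _ _)
          (Finset.mem_insert_self _ _)
      · simp at hx
end
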